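/- Let v : ℝ³ → ℝ³ be a smooth vector field that is 2π-periodic in x₃, each of whose components is harmonic (Δv = 0 in ℝ³), and such that ∫_{ℝ²×S¹} |∇v(x)|^q dx < ∞ for some q ∈ [2,∞). Then v is a constant vector. -/

import Mathlib

open MeasureTheory Real Set Filter Topology

noncomputable section

/-- Three-dimensional Euclidean space. -/
abbrev E3 := EuclideanSpace ℝ (Fin 3)

/-- The distance to the `x₃`-axis, `r = √(x₁² + x₂²)`. -/
def rr (x : E3) : ℝ := Real.sqrt ((x 0) ^ 2 + (x 1) ^ 2)

/-- Partial derivative of `g : ℝ³ → ℝ` in the `i`-th coordinate direction. -/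
def pd (i : Fin 3) (g : E3 → ℝ) (x : E3) : ℝ := fderiv ℝ g x (EuclideanSpace.single i 1)

/-- Partial derivative in the first (radial) variable of a function of `(r,z)`. -/
def dr (f : ℝ → ℝ → ℝ) (r z : ℝ) : ℝ := deriv (fun s => f s z) r

/-- Partial derivative in the second (vertical) variable of a function of `(r,z)`. -/
def dzz (f : ℝ → ℝ → ℝ) (r z : ℝ) : ℝ := deriv (fun t => f r t) z

/-- The azimuthal vorticity `ω^θ = ∂_z v^r − ∂_r v^z` of an axisymmetric vector
field without swirl, as a function of `(r,z)`. -/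
def omTheta (vr vz : ℝ → ℝ → ℝ) (r z : ℝ) : ℝ := dzz vr r z - dr vz r z

/-- The rescaled azimuthal vorticity `Ω = ω^θ / r`. -/
def Om (vr vz : ℝ → ℝ → ℝ) (r z : ℝ) : ℝ := omTheta vr vz r z / r

/-- The squared Frobenius norm `|∇v|² = ∑ᵢⱼ (∂ᵢ vⱼ)²` of the gradient of a
vector field `v : ℝ³ → ℝ³`. -/
def gradSq3 (v : E3 → E3) (x : E3) : ℝ := ∑ i, ∑ j, (pd i (fun y => v y j) x) ^ 2


/-- The quadratic cutoff `max (1 - ‖x‖²) 0`. -/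
def quadCutoff (x : E3) : ℝ := max (1 - ‖x‖ ^ 2) 0

lemma quadCutoff_nonneg (x : E3) : 0 ≤ quadCutoff x := le_max_right _ _

lemma quadCutoff_le_one (x : E3) : quadCutoff x ≤ 1 :=
  max_le (by nlinarith [sq_nonneg ‖x‖]) zero_le_one

lemma quadCutoff_eq_zero {x : E3} (hx : x ∉ Metric.closedBall (0 : E3) 1) :
    quadCutoff x = 0 := by
  rw [mem_closedBall_zero_iff, not_le] at hx
  exact max_eq_right (by nlinarith)

lemma continuous_quadCutoff : Continuous quadCutoff := by
  unfold quadCutoff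
  fun_prop

lemma integrable_quadCutoff_mul {f : E3 → ℝ} (hf : Continuous f) :
    Integrable (fun x => quadCutoff x * f x) := by
  refine (continuous_quadCutoff.mul hf).integrable_of_hasCompactSupport ?_
  refine HasCompactSupport.intro (isCompact_closedBall (0 : E3) 1) fun x hx => ?_
  simp [quadCutoff_eq_zero hx]

lemma integral_quadCutoff_pos : 0 < ∫ x, quadCutoff x := by
  refine continuous_quadCutoff.integral_pos_of_hasCompactSupport_nonneg_nonzero ?_
    quadCutoff_nonneg (x := 0) ?_
  · exact HasCompactSupport.intro (isCompact_closedBall (0 : E3) 1) fun x hx =>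
      quadCutoff_eq_zero hx
  · simp [quadCutoff]

lemma hasDerivAt_max_zero_sq (s : ℝ) :
    HasDerivAt (fun t : ℝ => max t 0 ^ 2) (2 * max s 0) s := by
  rcases lt_trichotomy s 0 with hs | rfl | hs
  · rw [max_eq_right hs.le, mul_zero]
    refine (hasDerivAt_const s (0 : ℝ)).congr_of_eventuallyEq ?_
    filter_upwards [eventually_lt_nhds hs] with t ht
    simp [max_eq_right ht.le]
  · rw [max_self, mul_zero]
    refine HasDerivAt.of_isLittleO ?_
    have h : (fun t : ℝ => t ^ 2) =o[𝓝 0] fun t => t := by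
      simpa using Asymptotics.isLittleO_pow_id (𝕜 := ℝ) (n := 2) one_lt_two
    refine Asymptotics.IsBigO.trans_isLittleO (g := fun t : ℝ => t ^ 2) ?_ (by simpa using h)
    refine Asymptotics.IsBigO.of_bound 1 (Eventually.of_forall fun t => ?_)
    rcases le_total t 0 with ht | ht <;> simp [ht, sq_nonneg]
  · rw [max_eq_left hs.le]
    have h : HasDerivAt (fun t : ℝ => t ^ 2) (2 * s) s := by
      simpa using hasDerivAt_pow 2 s
    refine h.congr_of_eventuallyEq ?_
    filter_upwards [eventually_gt_nhds hs] with t ht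
    simp [max_eq_left ht.le]

lemma hasFDerivAt_quadCutoff_sq (x : E3) :
    HasFDerivAt (fun y => quadCutoff y ^ 2)
      ((2 * quadCutoff x) • -(2 • innerSL ℝ x : E3 →L[ℝ] ℝ)) x := by
  have h : HasFDerivAt (fun y : E3 => 1 - ‖y‖ ^ 2) (-(2 • innerSL ℝ x : E3 →L[ℝ] ℝ)) x :=
    (hasStrictFDerivAt_norm_sq x).hasFDerivAt.const_sub 1
  exact (hasDerivAt_max_zero_sq (1 - ‖x‖ ^ 2)).comp_hasFDerivAt x h

lemma fderiv_quadCutoff_sq_single (x : E3) (i : Fin 3) :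
    fderiv ℝ (fun y => quadCutoff y ^ 2) x (EuclideanSpace.single i 1)
      = -4 * (quadCutoff x * x i) := by
  rw [(hasFDerivAt_quadCutoff_sq x).fderiv]
  simp [EuclideanSpace.inner_single_right]
  ring

lemma contDiff_pd {n m : WithTop ℕ∞} {g : E3 → ℝ} (hg : ContDiff ℝ n g) (hm : m + 1 ≤ n)
    (i : Fin 3) : ContDiff ℝ m (pd i g) :=
  (hg.fderiv_right hm).clm_apply contDiff_const

lemma pd_comm {g : E3 → ℝ} (hg : ContDiff ℝ 2 g) (i j : Fin 3) (x : E3) :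
    pd i (pd j g) x = pd j (pd i g) x := by
  have key : ∀ i j : Fin 3, pd i (pd j g) x
      = fderiv ℝ (fderiv ℝ g) x (EuclideanSpace.single i 1) (EuclideanSpace.single j 1) := by
    intro i j
    have h : DifferentiableAt ℝ (fderiv ℝ g) x :=
      ((hg.fderiv_right (m := 1) (by norm_num)).differentiable (by norm_num)) x
    have := (h.hasFDerivAt.clm_apply
      (hasFDerivAt_const (EuclideanSpace.single j (1 : ℝ) : E3) x)).fderiv
    unfold pd
    rw [this]
    simp
  rw [key, key]
  exact (hg.contDiffAt.isSymmSndFDerivAt (by simp)).eq _ _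

lemma fderiv_apply_eq_sum_pd (g : E3 → ℝ) (x y : E3) :
    fderiv ℝ g y x = ∑ i, x i * pd i g y := by
  have hx : x = ∑ i, x i • EuclideanSpace.single i (1 : ℝ) := by
    ext j
    simp [Finset.sum_apply, Pi.single_apply]
  conv_lhs => rw [hx]
  simp [pd]

lemma fderiv_comp_affine {f : E3 → ℝ} (hf : Differentiable ℝ f) (x₀ x w : E3) (r : ℝ) :
    fderiv ℝ (fun y => f (x₀ + r • y)) x w = r * fderiv ℝ f (x₀ + r • x) w := by
  have h : HasFDerivAt (fun y : E3 => x₀ + r • y) (r • ContinuousLinearMap.id ℝ E3) x :=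
    ((hasFDerivAt_id x).const_smul r).const_add x₀
  have h2 := ((hf (x₀ + r • x)).hasFDerivAt.comp x h).fderiv
  change fderiv ℝ (f ∘ fun y => x₀ + r • y) x w = _
  rw [h2]
  simp

/-- Integrating the radial derivative against the cutoff produces the Laplacian. -/
lemma integral_quadCutoff_mul_fderiv {g : E3 → ℝ} (hg : ContDiff ℝ 2 g)
    (hharm : ∀ x, ∑ i, pd i (pd i g) x = 0) (x₀ : E3) (r : ℝ) :
    ∫ x, quadCutoff x * fderiv ℝ g (x₀ + r • x) x = 0 := by
  have h1 : ∀ i, ContDiff ℝ 1 (pd i g) := fun i => contDiff_pd hg (by norm_num) i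
  have hc1 : ∀ i, Continuous (pd i g) := fun i => (h1 i).continuous
  have hc2 : ∀ i, Continuous (pd i (pd i g)) := fun i =>
    (contDiff_pd (m := 0) (h1 i) (by norm_num) i).continuous
  have hi : ∀ i : Fin 3, ∫ x : E3, quadCutoff x * (x i * pd i g (x₀ + r • x))
      = ∫ x, quadCutoff x * (quadCutoff x * (r / 4 * pd i (pd i g) (x₀ + r • x))) := by
    intro i
    have hd := (h1 i).differentiable (by norm_num)
    have hq := continuous_quadCutoff
    have key := integral_mul_fderiv_eq_neg_fderiv_mul_of_integrable
      (μ := (volume : Measure E3)) (v := EuclideanSpace.single i (1 : ℝ))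
      (f := fun y => quadCutoff y ^ 2) (g := fun y => pd i g (x₀ + r • y)) ?_ ?_ ?_
      (fun x _ => (hasFDerivAt_quadCutoff_sq x).differentiableAt)
      (fun x _ => (hd _).comp x (by fun_prop))
    · simp only [fderiv_quadCutoff_sq_single, fderiv_comp_affine hd] at key
      have e1 : ∀ x : E3, quadCutoff x * (x i * pd i g (x₀ + r • x))
          = -(1 / 4) * (-4 * (quadCutoff x * x i) * pd i g (x₀ + r • x)) := fun x => by ring
      have e2 : ∀ x : E3, quadCutoff x * (quadCutoff x * (r / 4 * pd i (pd i g) (x₀ + r • x)))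
          = (1 / 4) * (quadCutoff x ^ 2 * (r * fderiv ℝ (pd i g) (x₀ + r • x)
            (EuclideanSpace.single i 1))) := fun x => by
        rw [pd]; ring
      simp_rw [e1, e2]
      rw [integral_const_mul, integral_const_mul, key]
      ring
    · simp only [fderiv_quadCutoff_sq_single]
      refine (integrable_quadCutoff_mul
        (f := fun x => -4 * (x i * pd i g (x₀ + r • x))) (by fun_prop)).congr
        (Eventually.of_forall fun x => ?_)
      dsimp only
      ring
    · simp only [fderiv_comp_affine hd]
      refine (integrable_quadCutoff_mul
        (f := fun x => quadCutoff x * (r * pd i (pd i g) (x₀ + r • x))) (by fun_prop)).congr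
        (Eventually.of_forall fun x => ?_)
      dsimp only [pd]
      ring
    · refine (integrable_quadCutoff_mul
        (f := fun x => quadCutoff x * pd i g (x₀ + r • x)) (by fun_prop)).congr
        (Eventually.of_forall fun x => ?_)
      dsimp only
      ring
  have hq := continuous_quadCutoff
  simp_rw [fderiv_apply_eq_sum_pd, Finset.mul_sum]
  rw [integral_finsetSum _ fun i _ => integrable_quadCutoff_mul (by fun_prop)]
  simp_rw [hi]
  rw [← integral_finsetSum _ fun i _ => integrable_quadCutoff_mul (by fun_prop)]
  simp_rw [← Finset.mul_sum, hharm]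
  simp

lemma hasDerivAt_integral_quadCutoff {g : E3 → ℝ} (hg : ContDiff ℝ 1 g) (x₀ : E3) (r : ℝ) :
    HasDerivAt (fun s : ℝ => ∫ x, quadCutoff x * g (x₀ + s • x))
      (∫ x, quadCutoff x * fderiv ℝ g (x₀ + r • x) x) r := by
  have hc := hg.continuous
  have hc' : Continuous (fderiv ℝ g) := hg.continuous_fderiv (by norm_num)
  obtain ⟨C, hC⟩ := ((isCompact_closedBall r 1).prod
    (isCompact_closedBall (0 : E3) 1)).exists_bound_of_continuousOn
    (f := fun p : ℝ × E3 => fderiv ℝ g (x₀ + p.1 • p.2) p.2) (by fun_prop)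
  refine (hasDerivAt_integral_of_dominated_loc_of_deriv_le (μ := (volume : Measure E3))
    (F := fun s x => quadCutoff x * g (x₀ + s • x))
    (F' := fun s x => quadCutoff x * fderiv ℝ g (x₀ + s • x) x)
    (bound := fun x => quadCutoff x * C)
    (Metric.ball_mem_nhds r one_pos) ?_ ?_ ?_ ?_ ?_ ?_).2
  · exact Eventually.of_forall fun s =>
      (integrable_quadCutoff_mul (by fun_prop)).aestronglyMeasurable
  · exact integrable_quadCutoff_mul (by fun_prop)
  · exact (integrable_quadCutoff_mul (by fun_prop)).aestronglyMeasurable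
  · refine Eventually.of_forall fun x s hs => ?_
    rw [norm_mul, Real.norm_of_nonneg (quadCutoff_nonneg x)]
    by_cases hx : x ∈ Metric.closedBall (0 : E3) 1
    · exact mul_le_mul_of_nonneg_left (hC (s, x) ⟨Metric.ball_subset_closedBall hs, hx⟩)
        (quadCutoff_nonneg x)
    · simp [quadCutoff_eq_zero hx]
  · exact integrable_quadCutoff_mul continuous_const
  · refine Eventually.of_forall fun x s _ => ?_
    have h : HasDerivAt (fun s : ℝ => x₀ + s • x) x s := by
      simpa using ((hasDerivAt_id s).smul_const x).const_add x₀
    exact ((hg.differentiable (by norm_num) _).hasFDerivAt.comp_hasDerivAt s h).const_mul _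

/-- Weighted mean value property of harmonic functions on `ℝ³`. -/
lemma integral_quadCutoff_mul_harmonic {g : E3 → ℝ} (hg : ContDiff ℝ 2 g)
    (hharm : ∀ x, ∑ i, pd i (pd i g) x = 0) (x₀ : E3) (r : ℝ) :
    ∫ x, quadCutoff x * g (x₀ + r • x) = (∫ x, quadCutoff x) * g x₀ := by
  have hd : ∀ s, HasDerivAt (fun s : ℝ => ∫ x, quadCutoff x * g (x₀ + s • x)) 0 s := fun s => by
    simpa only [integral_quadCutoff_mul_fderiv hg hharm] using
      hasDerivAt_integral_quadCutoff (hg.of_le (by norm_num)) x₀ s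
  have h := is_const_of_deriv_eq_zero (fun s => (hd s).differentiableAt)
    (fun s => (hd s).deriv) r 0
  simpa [integral_mul_const] using h

lemma lintegral_ball_le_of_periodic {h : E3 → ENNReal} (hm : Measurable h)
    (hper : Function.Periodic h ((2 * π) • EuclideanSpace.single (2 : Fin 3) (1 : ℝ)))
    (x₀ : E3) (n : ℕ) :
    ∫⁻ x in Metric.closedBall x₀ n, h x
      ≤ ((2 * (n + ⌈|x₀ 2|⌉₊) + 1 : ℕ) : ENNReal)
        * ∫⁻ x in {x : E3 | x 2 ∈ Icc (-π) π}, h x := by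
  set S : Set E3 := {x : E3 | x 2 ∈ Icc (-π) π} with hS
  set K : ℕ := n + ⌈|x₀ 2|⌉₊ with hK
  set T : E3 := (2 * π) • EuclideanSpace.single (2 : Fin 3) (1 : ℝ) with hT
  have hSm : MeasurableSet S :=
    (isClosed_Icc.preimage (by fun_prop : Continuous fun x : E3 => x 2)).measurableSet
  have hT2 : ∀ (x : E3) (k : ℤ), (x - k • T) 2 = x 2 - k * (2 * π) := by
    intro x k
    simp [hT]
  have hcover : ∀ x, (Metric.closedBall x₀ (n : ℝ)).indicator h x
      ≤ ∑ k ∈ Finset.Icc (-(K : ℤ)) K, S.indicator h (x - k • T) := by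
    intro x
    by_cases hx : x ∈ Metric.closedBall x₀ (n : ℝ)
    · rw [Set.indicator_of_mem hx]
      have hxK : |x 2| ≤ K := by
        have h1 : |x 2 - x₀ 2| ≤ n := by
          rw [mem_closedBall_iff_norm] at hx
          simpa using (PiLp.norm_apply_le (x - x₀) 2).trans hx
        have h2 := Nat.le_ceil |x₀ 2|
        have h3 : (K : ℝ) = n + (⌈|x₀ 2|⌉₊ : ℝ) := by rw [hK]; push_cast; rfl
        have h4 := abs_sub_abs_le_abs_sub (x 2) (x₀ 2)
        linarith
      have hpi := Real.pi_gt_three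
      have hround := abs_sub_round (x 2 / (2 * π))
      set k := round (x 2 / (2 * π)) with hk
      have hdiv : x 2 = x 2 / (2 * π) * (2 * π) := by field_simp
      have hle : |x 2 / (2 * π)| ≤ K := by
        rw [abs_div, abs_of_pos (by positivity : 0 < 2 * π)]
        exact (div_le_self (abs_nonneg _) (by linarith)).trans hxK
      rw [abs_le] at hround hle
      have hkmem : k ∈ Finset.Icc (-(K : ℤ)) K := by
        rw [Finset.mem_Icc]
        have h1 : (k : ℝ) < K + 1 := by linarith
        have h2 : -(K : ℝ) - 1 < k := by linarith
        constructor
        · have : -(K : ℤ) - 1 < k := by exact_mod_cast h2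
          omega
        · have : k < (K : ℤ) + 1 := by exact_mod_cast h1
          omega
      have hxS : x - k • T ∈ S := by
        change (x - k • T) 2 ∈ Icc (-π) π
        rw [hT2, hdiv, ← sub_mul]
        constructor <;> nlinarith
      refine le_trans (le_of_eq ?_) (Finset.single_le_sum
        (f := fun k : ℤ => S.indicator h (x - k • T)) (fun _ _ => zero_le) hkmem)
      rw [Set.indicator_of_mem hxS, hper.sub_zsmul_eq]
    · rw [Set.indicator_of_notMem hx]
      exact zero_le
  have hind : Measurable (S.indicator h) := hm.indicator hSm
  calc ∫⁻ x in Metric.closedBall x₀ n, h x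
      = ∫⁻ x, (Metric.closedBall x₀ (n : ℝ)).indicator h x :=
        (lintegral_indicator Metric.isClosed_closedBall.measurableSet _).symm
    _ ≤ ∫⁻ x, ∑ k ∈ Finset.Icc (-(K : ℤ)) K, S.indicator h (x - k • T) :=
        lintegral_mono hcover
    _ = ∑ k ∈ Finset.Icc (-(K : ℤ)) K, ∫⁻ x, S.indicator h (x - k • T) :=
        lintegral_finsetSum _ fun k _ => hind.comp (measurable_id.sub_const _)
    _ = ∑ k ∈ Finset.Icc (-(K : ℤ)) K, ∫⁻ x in S, h x := by
        refine Finset.sum_congr rfl fun k _ => ?_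
        rw [lintegral_sub_right_eq_self (S.indicator h), lintegral_indicator hSm]
    _ = ((2 * K + 1 : ℕ) : ENNReal) * ∫⁻ x in S, h x := by
        rw [Finset.sum_const, nsmul_eq_mul, Int.card_Icc]
        congr 3
        omega

lemma exists_integral_quadCutoff_mul_le_div {H : E3 → ℝ} (hc : Continuous H)
    (hnn : ∀ x, 0 ≤ H x)
    (hper : Function.Periodic H ((2 * π) • EuclideanSpace.single (2 : Fin 3) (1 : ℝ)))
    (hfin : ∫⁻ x in {x : E3 | x 2 ∈ Icc (-π) π}, ENNReal.ofReal (H x) < ⊤) (x₀ : E3) :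
    ∃ B : ℝ, ∀ n : ℕ, 0 < n →
      ∫ x, quadCutoff x * H (x₀ + (n : ℝ) • x) ≤ B / n := by
  set I := ∫⁻ x in {x : E3 | x 2 ∈ Icc (-π) π}, ENNReal.ofReal (H x) with hI
  set m := ⌈|x₀ 2|⌉₊ with hm
  refine ⟨(2 * m + 3) * I.toReal, fun n hn => ?_⟩
  have hn1 : (1 : ℝ) ≤ n := by exact_mod_cast hn
  have hn0 : (n : ℝ) ≠ 0 := by positivity
  have hq := continuous_quadCutoff
  set F : E3 → ℝ := fun y => quadCutoff ((n : ℝ)⁻¹ • (y - x₀)) * H y with hF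
  have hFnn : ∀ y, 0 ≤ F y := fun y => mul_nonneg (quadCutoff_nonneg _) (hnn y)
  have hFle : ∀ y, ENNReal.ofReal (F y)
      ≤ (Metric.closedBall x₀ (n : ℝ)).indicator (fun y => ENNReal.ofReal (H y)) y := by
    intro y
    by_cases hy : y ∈ Metric.closedBall x₀ (n : ℝ)
    · rw [Set.indicator_of_mem hy]
      exact ENNReal.ofReal_le_ofReal (mul_le_of_le_one_left (hnn y) (quadCutoff_le_one _))
    · have : (n : ℝ)⁻¹ • (y - x₀) ∉ Metric.closedBall (0 : E3) 1 := by
        rw [mem_closedBall_iff_norm, not_le] at hy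
        rw [mem_closedBall_zero_iff, not_le, norm_smul, norm_inv, Real.norm_natCast,
          inv_mul_eq_div, one_lt_div (by positivity)]
        exact hy
      simp [hF, quadCutoff_eq_zero this]
  have hscale : ∫ x, quadCutoff x * H (x₀ + (n : ℝ) • x) = ((n : ℝ) ^ 3)⁻¹ * ∫ y, F y := by
    have h1 := Measure.integral_comp_smul (volume : Measure E3) (fun y => F (x₀ + y)) (n : ℝ)
    rw [integral_add_left_eq_self F x₀, finrank_euclideanSpace_fin,
      abs_of_nonneg (by positivity), smul_eq_mul] at h1
    rw [← h1]
    simp [hF, smul_smul, hn0]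
  have hbound : ∫ y, F y ≤ (2 * (n + m) + 1) * I.toReal := by
    rw [integral_eq_lintegral_of_nonneg_ae (Eventually.of_forall hFnn)
      (by fun_prop : Continuous F).aestronglyMeasurable]
    have hle : ∫⁻ y, ENNReal.ofReal (F y) ≤ ((2 * (n + m) + 1 : ℕ) : ENNReal) * I := by
      refine (lintegral_mono hFle).trans ?_
      rw [lintegral_indicator Metric.isClosed_closedBall.measurableSet]
      exact lintegral_ball_le_of_periodic hc.measurable.ennreal_ofReal
        (fun x => congrArg ENNReal.ofReal (hper x)) x₀ n
    refine (ENNReal.toReal_mono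
      (ENNReal.mul_ne_top (ENNReal.natCast_ne_top _) hfin.ne) hle).trans (le_of_eq ?_)
    rw [ENNReal.toReal_mul, ENNReal.toReal_natCast]
    push_cast
    rfl
  have hI0 : 0 ≤ I.toReal := ENNReal.toReal_nonneg
  have hm0 : (0 : ℝ) ≤ m := Nat.cast_nonneg m
  rw [hscale, inv_mul_eq_div, div_le_div_iff₀ (by positivity) (by positivity)]
  calc (∫ y, F y) * n ≤ (2 * (n + m) + 1) * I.toReal * n := by gcongr
    _ ≤ ((2 * m + 3) * n * n) * I.toReal * n := by
        gcongr
        nlinarith [mul_nonneg hm0 (by linarith : (0 : ℝ) ≤ n - 1),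
          mul_nonneg (mul_nonneg hm0 (by linarith : (0 : ℝ) ≤ n)) (by linarith : (0 : ℝ) ≤ n - 1)]
    _ = (2 * m + 3) * I.toReal * n ^ 3 := by ring

lemma le_add_rpow_mul_rpow {a ε q : ℝ} (ha : 0 ≤ a) (hε : 0 < ε) (hq : 1 ≤ q) :
    a ≤ ε + ε ^ (1 - q) * a ^ q := by
  have hpos : 0 ≤ ε ^ (1 - q) * a ^ q := by positivity
  rcases le_total a ε with h | h
  · linarith
  · have ha' : 0 < a := hε.trans_le h
    have h1 : a = a ^ (1 - q) * a ^ q := by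
      rw [← rpow_add ha']
      simp
    have h2 : a ^ (1 - q) ≤ ε ^ (1 - q) :=
      rpow_le_rpow_of_nonpos hε h (by linarith)
    have h3 : a ^ (1 - q) * a ^ q ≤ ε ^ (1 - q) * a ^ q := by gcongr
    linarith

/-- A harmonic function on `ℝ³` dominated in `L^q` by a function that is periodic in `x₃` and
integrable over a period vanishes identically. -/
lemma harmonic_eq_zero_of_rpow_le {g H : E3 → ℝ} {q : ℝ} (hq : 1 ≤ q) (hg : ContDiff ℝ 2 g)
    (hharm : ∀ x, ∑ i, pd i (pd i g) x = 0) (hc : Continuous H)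
    (hgH : ∀ x, |g x| ^ q ≤ H x)
    (hper : Function.Periodic H ((2 * π) • EuclideanSpace.single (2 : Fin 3) (1 : ℝ)))
    (hfin : ∫⁻ x in {x : E3 | x 2 ∈ Icc (-π) π}, ENNReal.ofReal (H x) < ⊤) (x₀ : E3) :
    g x₀ = 0 := by
  have hnn : ∀ x, 0 ≤ H x := fun x => (by positivity : 0 ≤ |g x| ^ q).trans (hgH x)
  obtain ⟨B, hB⟩ := exists_integral_quadCutoff_mul_le_div hc hnn hper hfin x₀
  have hgc := hg.continuous
  have hpos := integral_quadCutoff_pos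
  set c := ∫ x, quadCutoff x with hcdef
  have hest : ∀ ε : ℝ, 0 < ε → c * |g x₀| ≤ c * ε := by
    intro ε hε
    have hn : ∀ n : ℕ, 0 < n → c * |g x₀| ≤ c * ε + ε ^ (1 - q) * (B / n) := by
      intro n hn
      have hA : 0 ≤ ε ^ (1 - q) := by positivity
      calc c * |g x₀| = |∫ x, quadCutoff x * g (x₀ + (n : ℝ) • x)| := by
            rw [integral_quadCutoff_mul_harmonic hg hharm, abs_mul, abs_of_pos hpos]
        _ ≤ ∫ x, |quadCutoff x * g (x₀ + (n : ℝ) • x)| := abs_integral_le_integral_abs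
        _ ≤ ∫ x, (quadCutoff x * ε
              + ε ^ (1 - q) * (quadCutoff x * H (x₀ + (n : ℝ) • x))) := by
            refine integral_mono (integrable_quadCutoff_mul (by fun_prop)).abs
              ((integrable_quadCutoff_mul continuous_const).add
                ((integrable_quadCutoff_mul (by fun_prop)).const_mul _)) fun x => ?_
            have h1 := le_add_rpow_mul_rpow (abs_nonneg (g (x₀ + (n : ℝ) • x))) hε hq
            have h2 := mul_le_mul_of_nonneg_left (hgH (x₀ + (n : ℝ) • x)) hA
            have h3 := mul_le_mul_of_nonneg_left (h1.trans (add_le_add_right h2 ε))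
              (quadCutoff_nonneg x)
            dsimp only
            rw [abs_mul, abs_of_nonneg (quadCutoff_nonneg x)]
            linarith
        _ = c * ε + ε ^ (1 - q) * ∫ x, quadCutoff x * H (x₀ + (n : ℝ) • x) := by
            rw [integral_add (integrable_quadCutoff_mul continuous_const)
              ((integrable_quadCutoff_mul (by fun_prop)).const_mul _), integral_mul_const,
              integral_const_mul]
        _ ≤ c * ε + ε ^ (1 - q) * (B / n) := by
            gcongr
            exact hB n hn
    have hlim : Tendsto (fun n : ℕ => c * ε + ε ^ (1 - q) * (B / n)) atTop (𝓝 (c * ε)) := by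
      simpa using ((tendsto_const_div_atTop_nhds_zero_nat B).const_mul
        (ε ^ (1 - q))).const_add (c * ε)
    refine ge_of_tendsto hlim ?_
    filter_upwards [eventually_gt_atTop 0] with n hn' using hn n hn'
  have h0 : |g x₀| ≤ 0 := le_of_forall_pos_le_add fun ε hε => by
    simpa using le_of_mul_le_mul_left (hest ε hε) hpos
  exact abs_nonpos_iff.mp h0

lemma pd_periodic {g : E3 → ℝ} {T : E3} (hg : Function.Periodic g T) (i : Fin 3) :
    Function.Periodic (pd i g) T := by
  intro x
  unfold pd
  rw [← fderiv_comp_add_right]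
  simp_rw [hg _]

/-- Partial derivatives of harmonic functions are harmonic. -/
lemma sum_pd_pd_pd_eq_zero {u : E3 → ℝ} (hu : ContDiff ℝ 3 u)
    (hharm : ∀ x, ∑ i, pd i (pd i u) x = 0) (k : Fin 3) (x : E3) :
    ∑ i, pd i (pd i (pd k u)) x = 0 := by
  have hu2 : ContDiff ℝ 2 u := hu.of_le (by norm_num)
  have h1 : ∀ i, ContDiff ℝ 2 (pd i u) := fun i => contDiff_pd hu (by norm_num) i
  have h2 : ∀ i, ContDiff ℝ 1 (pd i (pd i u)) := fun i => contDiff_pd (h1 i) (by norm_num) i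
  have hswap : ∀ i, pd i (pd i (pd k u)) x = pd k (pd i (pd i u)) x := by
    intro i
    rw [show pd i (pd k u) = pd k (pd i u) from funext (pd_comm hu2 i k)]
    exact pd_comm (h1 i) i k x
  simp_rw [hswap]
  have hsum : pd k (fun y => ∑ i, pd i (pd i u) y) x = ∑ i, pd k (pd i (pd i u)) x := by
    change fderiv ℝ (fun y => ∑ i, pd i (pd i u) y) x (EuclideanSpace.single k 1) = _
    rw [fderiv_fun_sum fun i _ => (h2 i).differentiable (by norm_num) x]
    simp [pd]
  rw [← hsum, funext hharm]
  simp [pd]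

/-- a smooth vector field on `ℝ³`, `2π`-periodic in `x₃`, with
harmonic components and finite generalized Dirichlet integral over `ℝ² × S¹`,
must be constant. -/
theorem harmonic_periodic_liouville (q : ℝ) (hq : 2 ≤ q) (v : E3 → E3)
    (hsmooth : ContDiff ℝ (⊤ : ℕ∞) v)
    (hper : ∀ x : E3, v (x + (2 * π) • EuclideanSpace.single (2 : Fin 3) (1 : ℝ)) = v x)
    (hharm : ∀ x : E3, ∀ j : Fin 3, (∑ i, pd i (pd i (fun y => v y j)) x) = 0)
    (hdiri : ∫⁻ x : E3 in {x : E3 | x 2 ∈ Icc (-π) π},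
      ENNReal.ofReal ((gradSq3 v x) ^ (q / 2)) < ⊤) :
    ∃ c : E3, ∀ x : E3, v x = c := by
  have hv3 : ContDiff ℝ 3 v := contDiff_infty.mp hsmooth 3
  have hv : ∀ j, ContDiff ℝ 3 (fun y => v y j) := fun j => by fun_prop
  have hpd : ∀ i j, ContDiff ℝ 2 (pd i (fun y => v y j)) := fun i j =>
    contDiff_pd (hv j) (by norm_num) i
  have hpc : ∀ i j, Continuous (pd i (fun y => v y j)) := fun i j => (hpd i j).continuous
  have hH : Continuous fun x => gradSq3 v x ^ (q / 2) := by
    refine Continuous.rpow_const ?_ fun x => Or.inr (by linarith)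
    unfold gradSq3
    fun_prop
  have hHper : Function.Periodic (fun x => gradSq3 v x ^ (q / 2))
      ((2 * π) • EuclideanSpace.single (2 : Fin 3) (1 : ℝ)) := by
    intro x
    have h := fun i j => pd_periodic (g := fun y => v y j)
      (fun y => congrArg (fun w : E3 => w j) (hper y)) i x
    simp only [gradSq3, h]
  have hzero : ∀ i j x, pd i (fun y => v y j) x = 0 := by
    intro i j x
    refine harmonic_eq_zero_of_rpow_le (q := q) (by linarith) (hpd i j)
      (sum_pd_pd_pd_eq_zero (hv j)
        (fun y => hharm y j) i) hH (fun y => ?_) hHper hdiri x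
    have hle : pd i (fun y => v y j) y ^ 2 ≤ gradSq3 v y :=
      (Finset.single_le_sum (f := fun j => pd i (fun y => v y j) y ^ 2)
        (fun _ _ => sq_nonneg _) (Finset.mem_univ j)).trans
      (Finset.single_le_sum (f := fun i => ∑ j, pd i (fun y => v y j) y ^ 2)
        (fun _ _ => Finset.sum_nonneg fun _ _ => sq_nonneg _) (Finset.mem_univ i))
    calc |pd i (fun y => v y j) y| ^ q = (pd i (fun y => v y j) y ^ 2) ^ (q / 2) := by
          rw [← sq_abs, ← rpow_natCast, ← rpow_mul (abs_nonneg _)]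
          congr 1
          push_cast
          ring
      _ ≤ gradSq3 v y ^ (q / 2) := rpow_le_rpow (sq_nonneg _) hle (by linarith)
  refine ⟨v 0, fun x => ?_⟩
  ext j
  refine is_const_of_fderiv_eq_zero (𝕜 := ℝ) ((hv j).differentiable (by norm_num)) (fun y => ?_) x 0
  ext w
  simp [fderiv_apply_eq_sum_pd, hzero]
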